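/- Assume the chain is transient, i.e. ∑_{k=1}^∞ ∏_{i=1}^{k} U_i < ∞ (equivalently D(0,∞) < ∞). Then for every R = 0,1,2,… and every L = 1,2,…, P( ξ(R,∞) = L ) = q_R (1 − q_R)^{L−1} with q_R = (1 + 2 p_R)/(2 D(R,∞)); that is, the total local time at R is geometrically distributed with parameter (1+2p_R)/(2D(R,∞)). -/

import Mathlib

open MeasureTheory Filter Finset
open scoped ENNReal NNReal Topology

noncomputable section

namespace NNRW

/-- Probability of a step to the right from site `i`: `E 0 = 1`, `E i = 1/2 + p i` for `i ≥ 1`. -/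
def E (p : ℕ → ℝ) (i : ℕ) : ℝ := if i = 0 then 1 else 1 / 2 + p i

/-- One-step transition probability of the nearest-neighbour walk, from `i` to `j`. -/
def step (p : ℕ → ℝ) (i j : ℕ) : ℝ :=
  if j = i + 1 then E p i else if j + 1 = i then 1 - E p i else 0

/-- `X` is (distributed as) the nearest-neighbour Markov chain with parameters `p`, started
at `b`, under the probability measure `P`: `X 0 = b` and the finite-dimensional
distributions are the products of the one-step transition probabilities. -/
def IsNNWalk {Ω : Type*} [MeasurableSpace Ω] (P : Measure Ω)
    (X : ℕ → Ω → ℕ) (p : ℕ → ℝ) (b : ℕ) : Prop :=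
  (∀ ω, X 0 ω = b) ∧
    ∀ (n : ℕ) (u : ℕ → ℕ), u 0 = b →
      P {ω | ∀ k ≤ n, X k ω = u k} =
        ENNReal.ofReal (∏ k ∈ Finset.range n, step p (u k) (u (k + 1)))

/-- `U i = (1/2 - p i)/(1/2 + p i)`. -/
def U (p : ℕ → ℝ) (i : ℕ) : ℝ := (1 / 2 - p i) / (1 / 2 + p i)

/-- `D(m,n)` for finite `m ≤ n`. -/
def Dfin (p : ℕ → ℝ) (m n : ℕ) : ℝ :=
  if n = m then 0
  else 1 + ∑ j ∈ Finset.Icc 1 (n - m - 1), ∏ i ∈ Finset.Icc 1 j, U p (m + i)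

/-- `D(m,∞) = lim_{n → ∞} D(m,n) ∈ (0,∞]`. -/
def Dinf (p : ℕ → ℝ) (m : ℕ) : ℝ≥0∞ :=
  1 + ∑' j : ℕ, ENNReal.ofReal (∏ i ∈ Finset.Icc 1 (j + 1), U p (m + i))

/-- Event: the walk visits `a` (strictly) before it ever visits `c`. -/
def hitsBefore {Ω : Type*} (X : ℕ → Ω → ℕ) (a c : ℕ) : Set Ω :=
  {ω | ∃ n, X n ω = a ∧ ∀ k < n, X k ω ≠ c}

/-- Event: the walk ever visits `a`. -/
def hits {Ω : Type*} (X : ℕ → Ω → ℕ) (a : ℕ) : Set Ω := {ω | ∃ n, X n ω = a}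

/-- Total local time `ξ(x,∞)` at site `x` (equal to `∞` if there are infinitely many
visits). -/
def localTime {Ω : Type*} (X : ℕ → Ω → ℕ) (x : ℕ) (ω : Ω) : ℝ≥0∞ :=
  ∑' k : ℕ, Set.indicator {k | X k ω = x} (fun _ => (1 : ℝ≥0∞)) k

/-- Total number of upcrossings `ξ(x,∞,↑)` at site `x`. -/
def upcross {Ω : Type*} (X : ℕ → Ω → ℕ) (x : ℕ) (ω : Ω) : ℝ≥0∞ :=
  ∑' k : ℕ, Set.indicator {k | X k ω = x ∧ X (k + 1) ω = x + 1} (fun _ => (1 : ℝ≥0∞)) k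

/-- Iterated logarithm: `iterLog 0 x = x`, `iterLog (k+1) x = log (iterLog k x)`. -/
def iterLog : ℕ → ℝ → ℝ
  | 0, x => x
  | k + 1, x => Real.log (iterLog k x)

/-- `λ(k,x)`: `lam 0 x = 1`, `lam (k+1) x = lam k x * log_k x`. -/
def lam : ℕ → ℝ → ℝ
  | 0, _ => 1
  | k + 1, x => lam k x * iterLog k x

/-- `Λ(K,x,B) = Λ(K-1,x) + B/λ(K,x)` where `Λ(K,x) = ∑_{k=1}^{K} 1/λ(k,x)`. -/
def LamB (K : ℕ) (B : ℝ) (x : ℝ) : ℝ :=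
  (∑ k ∈ Finset.Icc 1 (K - 1), 1 / lam k x) + B / lam K x

/-- The truncation convention: with `i₀ = min{i ≥ 1 : q i < 1/2}` one has `p i = q i₀`
for `1 ≤ i ≤ i₀` and `p i = q i` for `i > i₀`. -/
def IsTruncation (q p : ℕ → ℝ) : Prop :=
  ∃ i0 : ℕ, 1 ≤ i0 ∧ q i0 < 1 / 2 ∧ (∀ i, 1 ≤ i → i < i0 → ¬ q i < 1 / 2) ∧
    (∀ i, 1 ≤ i → i ≤ i0 → p i = q i0) ∧ ∀ i, i0 < i → p i = q i

end NNRW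

namespace NNRW

section Parameters

variable {p : ℕ → ℝ}

lemma E_zero (p : ℕ → ℝ) : E p 0 = 1 := by simp [E]

lemma E_pos (hp : ∀ i, 1 ≤ i → 0 ≤ p i ∧ p i < 1 / 2) (i : ℕ) : 0 < E p i := by
  unfold E
  split_ifs with h
  · norm_num
  · linarith [(hp i (by omega)).1]

lemma E_le_one (hp : ∀ i, 1 ≤ i → 0 ≤ p i ∧ p i < 1 / 2) (i : ℕ) : E p i ≤ 1 := by
  unfold E
  split_ifs with h
  · norm_num
  · linarith [(hp i (by omega)).2]

lemma U_pos (hp : ∀ i, 1 ≤ i → 0 ≤ p i ∧ p i < 1 / 2) {i : ℕ} (hi : 1 ≤ i) : 0 < U p i := by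
  obtain ⟨h1, h2⟩ := hp i hi
  exact div_pos (by linarith) (by linarith)

lemma E_mul_U (hp : ∀ i, 1 ≤ i → 0 ≤ p i ∧ p i < 1 / 2) {i : ℕ} (hi : 1 ≤ i) :
    E p i * U p i = 1 - E p i := by
  have h1 := (hp i hi).1
  have h2 : (1 / 2 + p i) ≠ 0 := by linarith
  rw [E, if_neg (by omega), U]
  field_simp
  ring

lemma step_succ (p : ℕ → ℝ) (i : ℕ) : step p i (i + 1) = E p i := by simp [step]

lemma step_pred (p : ℕ → ℝ) (i : ℕ) : step p i (i - 1) = 1 - E p i := by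
  rcases i with _ | i
  · simp [step, E]
  · rw [step, if_neg (by omega), if_pos (by omega)]

lemma step_eq_zero (p : ℕ → ℝ) {i j : ℕ} (h1 : j ≠ i + 1) (h2 : j ≠ i - 1) :
    step p i j = 0 := by
  rw [step, if_neg h1, if_neg (by omega)]

lemma step_nonneg (hp : ∀ i, 1 ≤ i → 0 ≤ p i ∧ p i < 1 / 2) (i j : ℕ) : 0 ≤ step p i j := by
  unfold step
  split_ifs
  · exact (E_pos hp i).le
  · linarith [E_le_one hp i]
  · exact le_rfl

/-- The product `U (m+1) ⋯ U (m+k)`. -/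
def prodU (p : ℕ → ℝ) (m k : ℕ) : ℝ := ∏ i ∈ Finset.Icc 1 k, U p (m + i)

lemma prodU_zero (p : ℕ → ℝ) (m : ℕ) : prodU p m 0 = 1 := by simp [prodU]

lemma prodU_succ (p : ℕ → ℝ) (m k : ℕ) :
    prodU p m (k + 1) = prodU p m k * U p (m + (k + 1)) := by
  simp [prodU, Finset.prod_Icc_succ_top]

lemma prodU_pos (hp : ∀ i, 1 ≤ i → 0 ≤ p i ∧ p i < 1 / 2) (m k : ℕ) : 0 < prodU p m k :=
  Finset.prod_pos fun i hi => U_pos hp (by have := Finset.mem_Icc.1 hi; omega)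

lemma prodU_add (p : ℕ → ℝ) (m k : ℕ) : prodU p 0 (m + k) = prodU p 0 m * prodU p m k := by
  induction k with
  | zero => simp [prodU_zero]
  | succ k ih => rw [← add_assoc, prodU_succ, ih, prodU_succ, mul_assoc, zero_add, add_assoc]

lemma E_mul_prodU_succ (hp : ∀ i, 1 ≤ i → 0 ≤ p i ∧ p i < 1 / 2) (m k : ℕ) :
    E p (m + (k + 1)) * prodU p m (k + 1) = (1 - E p (m + (k + 1))) * prodU p m k := by
  rw [prodU_succ, ← E_mul_U hp (by omega : 1 ≤ m + (k + 1))]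
  ring

lemma Dinf_eq_tsum (p : ℕ → ℝ) (m : ℕ) : Dinf p m = ∑' k, ENNReal.ofReal (prodU p m k) := by
  rw [tsum_eq_zero_add' ENNReal.summable, prodU_zero, ENNReal.ofReal_one]
  rfl

lemma summable_prodU (hp : ∀ i, 1 ≤ i → 0 ≤ p i ∧ p i < 1 / 2) (htrans : Dinf p 0 < ⊤)
    (m : ℕ) : Summable (prodU p m) := by
  have h0 : Summable (prodU p 0) := by
    rw [Dinf_eq_tsum] at htrans
    have := ENNReal.summable_toReal htrans.ne
    simpa [ENNReal.toReal_ofReal (prodU_pos hp 0 _).le] using this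
  have h1 : Summable fun k => prodU p 0 (m + k) := by
    simpa [add_comm] using (summable_nat_add_iff m).2 h0
  simp_rw [prodU_add] at h1
  exact (summable_mul_left_iff (prodU_pos hp 0 m).ne').1 h1

lemma toReal_Dinf (hp : ∀ i, 1 ≤ i → 0 ≤ p i ∧ p i < 1 / 2) (m : ℕ) :
    (Dinf p m).toReal = ∑' k, prodU p m k := by
  rw [Dinf_eq_tsum, ENNReal.tsum_toReal_eq (fun _ => ENNReal.ofReal_ne_top)]
  exact tsum_congr fun k => ENNReal.toReal_ofReal (prodU_pos hp m k).le

/-- The scale function `D(m, m + k)`. -/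
def scale (p : ℕ → ℝ) (m k : ℕ) : ℝ := ∑ j ∈ Finset.range k, prodU p m j

lemma scale_zero (p : ℕ → ℝ) (m : ℕ) : scale p m 0 = 0 := by simp [scale]

lemma scale_one (p : ℕ → ℝ) (m : ℕ) : scale p m 1 = 1 := by simp [scale, prodU_zero]

lemma scale_succ (p : ℕ → ℝ) (m k : ℕ) : scale p m (k + 1) = scale p m k + prodU p m k :=
  Finset.sum_range_succ _ _

lemma scale_mono (hp : ∀ i, 1 ≤ i → 0 ≤ p i ∧ p i < 1 / 2) (m : ℕ) : Monotone (scale p m) :=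
  monotone_nat_of_le_succ fun k => by
    rw [scale_succ]
    linarith [prodU_pos hp m k]

/-- Harmonicity of the scale function above `m`. -/
lemma scale_harmonic (hp : ∀ i, 1 ≤ i → 0 ≤ p i ∧ p i < 1 / 2) (m k : ℕ) :
    scale p m (k + 1) = E p (m + (k + 1)) * scale p m (k + 2) +
      (1 - E p (m + (k + 1))) * scale p m k := by
  have h := E_mul_prodU_succ hp m k
  rw [scale_succ p m (k + 1), scale_succ p m k]
  linear_combination -h

lemma tendsto_scale (hp : ∀ i, 1 ≤ i → 0 ≤ p i ∧ p i < 1 / 2) (htrans : Dinf p 0 < ⊤)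
    (m : ℕ) : Tendsto (scale p m) atTop (𝓝 (Dinf p m).toReal) := by
  rw [toReal_Dinf hp]
  exact (summable_prodU hp htrans m).hasSum.tendsto_sum_nat

lemma scale_le_Dinf (hp : ∀ i, 1 ≤ i → 0 ≤ p i ∧ p i < 1 / 2) (htrans : Dinf p 0 < ⊤)
    (m k : ℕ) : scale p m k ≤ (Dinf p m).toReal :=
  (scale_mono hp m).ge_of_tendsto (tendsto_scale hp htrans m) k

lemma one_le_Dinf (hp : ∀ i, 1 ≤ i → 0 ≤ p i ∧ p i < 1 / 2) (htrans : Dinf p 0 < ⊤)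
    (m : ℕ) : 1 ≤ (Dinf p m).toReal :=
  (scale_one p m).symm.trans_le (scale_le_Dinf hp htrans m 1)

end Parameters

/-- The probability of ever hitting `R` from `i`. -/
def hitProb (p : ℕ → ℝ) (R i : ℕ) : ℝ := 1 - scale p R (i - R) / (Dinf p R).toReal

/-- The parameter of the geometric law of the local time at `R`. -/
def escProb (p : ℕ → ℝ) (R : ℕ) : ℝ := E p R / (Dinf p R).toReal

/-- The probability, starting from `i`, of visiting `R` at least `r` times. -/
def visitProb (p : ℕ → ℝ) (R i : ℕ) : ℕ → ℝ
  | 0 => 1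
  | r + 1 => hitProb p R i * (1 - escProb p R) ^ r

/-- The number of visits to `R` still required after a visit of `i`, if `r` were required before. -/
def remaining (R i r : ℕ) : ℕ := if i = R then r - 1 else r

open Classical in
/-- The probability, starting from `i`, that the number of visits to `R` during the time
interval `[0, n]`, truncatedly subtracted from `r`, lies in `S`. -/
def finVisitProb (p : ℕ → ℝ) (R : ℕ) (S : Set ℕ) : ℕ → ℕ → ℕ → ℝ
  | 0, i, r => if remaining R i r ∈ S then 1 else 0
  | n + 1, i, r => E p i * finVisitProb p R S n (i + 1) (remaining R i r) +
      (1 - E p i) * finVisitProb p R S n (i - 1) (remaining R i r)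

section Analysis

variable {p : ℕ → ℝ}

lemma hitProb_of_le (p : ℕ → ℝ) {R i : ℕ} (h : i ≤ R) : hitProb p R i = 1 := by
  simp [hitProb, Nat.sub_eq_zero_of_le h, scale_zero]

lemma hitProb_harmonic (hp : ∀ i, 1 ≤ i → 0 ≤ p i ∧ p i < 1 / 2)
    {R i : ℕ} (h : i ≠ R) :
    hitProb p R i = E p i * hitProb p R (i + 1) + (1 - E p i) * hitProb p R (i - 1) := by
  rcases lt_or_gt_of_ne h with h | h
  · rw [hitProb_of_le p h.le, hitProb_of_le p h, hitProb_of_le p (by omega)]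
    ring
  · obtain ⟨k, rfl⟩ : ∃ k, i = R + (k + 1) := ⟨i - R - 1, by omega⟩
    have e1 : R + (k + 1) - R = k + 1 := by omega
    have e2 : R + (k + 1) + 1 - R = k + 2 := by omega
    have e3 : R + (k + 1) - 1 - R = k := by omega
    simp only [hitProb, e1, e2, e3]
    rw [scale_harmonic hp R k]
    ring

lemma one_sub_escProb (p : ℕ → ℝ) (R : ℕ) :
    1 - escProb p R = E p R * hitProb p R (R + 1) + (1 - E p R) * hitProb p R (R - 1) := by
  rw [hitProb_of_le p (Nat.sub_le R 1), hitProb, escProb, Nat.add_sub_cancel_left, scale_one]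
  ring

lemma visitProb_harmonic (hp : ∀ i, 1 ≤ i → 0 ≤ p i ∧ p i < 1 / 2)
    (R i r : ℕ) :
    visitProb p R i r = E p i * visitProb p R (i + 1) (remaining R i r) +
      (1 - E p i) * visitProb p R (i - 1) (remaining R i r) := by
  by_cases h : i = R
  · subst h
    rcases r with _ | _ | r
    · simp [remaining, visitProb]
    · simp [remaining, visitProb, hitProb_of_le]
    · have h1 := one_sub_escProb p i
      simp only [remaining, if_true, Nat.add_sub_cancel, visitProb, hitProb_of_le p le_rfl]
      rw [pow_succ]
      linear_combination (1 - escProb p i) ^ r * h1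
  · rcases r with _ | r
    · simp [remaining, visitProb]
    · simp only [remaining, if_neg h, visitProb]
      rw [hitProb_harmonic hp h]
      ring

lemma finVisitProb_nonneg (hp : ∀ i, 1 ≤ i → 0 ≤ p i ∧ p i < 1 / 2)
    (R : ℕ) (S : Set ℕ) (n i r : ℕ) :
    0 ≤ finVisitProb p R S n i r := by
  induction n generalizing i r with
  | zero =>
    unfold finVisitProb
    split_ifs <;> norm_num
  | succ n ih =>
    exact add_nonneg (mul_nonneg (E_pos hp i).le (ih _ _))
      (mul_nonneg (by linarith [E_le_one hp i]) (ih _ _))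

lemma finVisitProb_add_compl (p : ℕ → ℝ) (R : ℕ) (S : Set ℕ) (n i r : ℕ) :
    finVisitProb p R S n i r + finVisitProb p R Sᶜ n i r = 1 := by
  induction n generalizing i r with
  | zero => by_cases h : remaining R i r ∈ S <;> simp [finVisitProb, h]
  | succ n ih =>
    simp only [finVisitProb]
    linear_combination E p i * ih (i + 1) (remaining R i r) +
      (1 - E p i) * ih (i - 1) (remaining R i r)

lemma finVisitProb_zero_right (p : ℕ → ℝ) (R n i : ℕ) : finVisitProb p R {0} n i 0 = 1 := by
  have h : ∀ i, remaining R i 0 = 0 := fun i => by simp [remaining]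
  induction n generalizing i with
  | zero => simp [finVisitProb, h]
  | succ n ih => simp [finVisitProb, h, ih]

lemma finVisitProb_mono (hp : ∀ i, 1 ≤ i → 0 ≤ p i ∧ p i < 1 / 2)
    (R i r : ℕ) : Monotone fun n => finVisitProb p R {0} n i r := by
  refine monotone_nat_of_le_succ fun n => ?_
  induction n generalizing i r with
  | zero =>
    by_cases h : remaining R i r = 0
    · have e : finVisitProb p R {0} (0 + 1) i r = 1 := by
        rw [finVisitProb, h, finVisitProb_zero_right, finVisitProb_zero_right]
        ring
      rw [e]
      simp [finVisitProb, h]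
    · have e : finVisitProb p R {0} 0 i r = 0 := by simp [finVisitProb, h]
      rw [e]
      exact finVisitProb_nonneg hp R _ _ i r
  | succ n ih =>
    have := E_le_one hp i
    exact add_le_add (mul_le_mul_of_nonneg_left (ih _ _) (E_pos hp i).le)
      (mul_le_mul_of_nonneg_left (ih _ _) (by linarith))

lemma hitProb_nonneg (hp : ∀ i, 1 ≤ i → 0 ≤ p i ∧ p i < 1 / 2) (htrans : Dinf p 0 < ⊤)
    (R i : ℕ) : 0 ≤ hitProb p R i := by
  have h1 := one_le_Dinf hp htrans R
  have := div_le_one_of_le₀ (scale_le_Dinf hp htrans R (i - R)) (by linarith)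
  rw [hitProb]
  linarith

lemma escProb_nonneg (hp : ∀ i, 1 ≤ i → 0 ≤ p i ∧ p i < 1 / 2)
    (R : ℕ) : 0 ≤ escProb p R :=
  div_nonneg (E_pos hp R).le ENNReal.toReal_nonneg

lemma escProb_le_one (hp : ∀ i, 1 ≤ i → 0 ≤ p i ∧ p i < 1 / 2) (htrans : Dinf p 0 < ⊤)
    (R : ℕ) : escProb p R ≤ 1 :=
  div_le_one_of_le₀ ((E_le_one hp R).trans (one_le_Dinf hp htrans R)) ENNReal.toReal_nonneg

lemma visitProb_nonneg (hp : ∀ i, 1 ≤ i → 0 ≤ p i ∧ p i < 1 / 2) (htrans : Dinf p 0 < ⊤)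
    (R i r : ℕ) : 0 ≤ visitProb p R i r := by
  rcases r with _ | r
  · exact zero_le_one
  · exact mul_nonneg (hitProb_nonneg hp htrans R i)
      (pow_nonneg (by linarith [escProb_le_one hp htrans R]) r)

lemma visitProb_succ_le (hp : ∀ i, 1 ≤ i → 0 ≤ p i ∧ p i < 1 / 2) (htrans : Dinf p 0 < ⊤)
    (R i r : ℕ) : visitProb p R i (r + 1) ≤ hitProb p R i :=
  mul_le_of_le_one_right (hitProb_nonneg hp htrans R i)
    (pow_le_one₀ (by linarith [escProb_le_one hp htrans R])
      (by linarith [escProb_nonneg hp R]))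

lemma tendsto_hitProb (hp : ∀ i, 1 ≤ i → 0 ≤ p i ∧ p i < 1 / 2) (htrans : Dinf p 0 < ⊤)
    (R : ℕ) : Tendsto (fun k => hitProb p R (R + k)) atTop (𝓝 0) := by
  have hD := one_le_Dinf hp htrans R
  have h := ((tendsto_scale hp htrans R).div_const (Dinf p R).toReal).const_sub 1
  rw [div_self (by linarith), sub_self] at h
  simpa [hitProb] using h

/-- A nonnegative function, harmonic off `R`, vanishing at `R` and dominated by the hitting
probability of `R`, is identically zero. -/
lemma eq_zero_of_harmonic (hp : ∀ i, 1 ≤ i → 0 ≤ p i ∧ p i < 1 / 2) (htrans : Dinf p 0 < ⊤)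
    {R : ℕ} {f : ℕ → ℝ} (hf0 : ∀ i, 0 ≤ f i) (hfR : f R = 0)
    (hle : ∀ i, f i ≤ hitProb p R i)
    (hf : ∀ i, i ≠ R → f i = E p i * f (i + 1) + (1 - E p i) * f (i - 1)) (i : ℕ) :
    f i = 0 := by
  have below : ∀ k, k < R → f (k + 1) = f k := by
    intro k
    induction k with
    | zero =>
      intro hk
      have := hf 0 hk.ne
      rw [E_zero] at this
      linarith
    | succ k ih =>
      intro hk
      have h1 := hf (k + 1) hk.ne
      have h2 := ih (by omega)
      rw [Nat.add_sub_cancel] at h1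
      have h3 : E p (k + 1) * (f (k + 1 + 1) - f (k + 1)) = 0 := by
        linear_combination -h1 + (1 - E p (k + 1)) * h2
      rcases mul_eq_zero.1 h3 with h | h
      · exact absurd h (E_pos hp _).ne'
      · linarith
  have const : ∀ k, k ≤ R → f k = f 0 := by
    intro k
    induction k with
    | zero => simp
    | succ k ih => exact fun hk => (below k hk).trans (ih (by omega))
  have above : ∀ k, f (R + (k + 1)) - f (R + k) = f (R + 1) * prodU p R k := by
    intro k
    induction k with
    | zero => simp [hfR, prodU_zero]
    | succ k ih =>
      have h1 := hf (R + (k + 1)) (by omega)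
      have e : R + (k + 1) - 1 = R + k := by omega
      rw [e] at h1
      have h2 := E_mul_prodU_succ hp R k
      refine mul_left_cancel₀ (E_pos hp (R + (k + 1))).ne' ?_
      rw [← add_assoc R (k + 1) 1]
      linear_combination -h1 + (1 - E p (R + (k + 1))) * ih - f (R + 1) * h2
  have value : ∀ k, f (R + k) = f (R + 1) * scale p R k := by
    intro k
    induction k with
    | zero => simp [hfR, scale_zero]
    | succ k ih =>
      rw [scale_succ]
      linear_combination above k + ih
  have hR1 : f (R + 1) = 0 := by
    refine le_antisymm (ge_of_tendsto (tendsto_hitProb hp htrans R) ?_) (hf0 _)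
    filter_upwards [eventually_ge_atTop 1] with k hk
    have h1 : 1 ≤ scale p R k := (scale_one p R).symm.trans_le (scale_mono hp R hk)
    calc f (R + 1) ≤ f (R + 1) * scale p R k := le_mul_of_one_le_right (hf0 _) h1
      _ = f (R + k) := (value k).symm
      _ ≤ _ := hle _
  rcases le_total i R with h | h
  · rw [const i h, ← const R le_rfl, hfR]
  · obtain ⟨k, rfl⟩ := Nat.exists_eq_add_of_le h
    rw [value, hR1, zero_mul]

lemma finVisitProb_le_visitProb (hp : ∀ i, 1 ≤ i → 0 ≤ p i ∧ p i < 1 / 2) (htrans : Dinf p 0 < ⊤)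
    (R n i r : ℕ) :
    finVisitProb p R {0} n i r ≤ visitProb p R i r := by
  induction n generalizing i r with
  | zero =>
    by_cases h : remaining R i r = 0
    · rw [visitProb_harmonic hp, h]
      simp [finVisitProb, h, visitProb]
    · simpa [finVisitProb, h] using visitProb_nonneg hp htrans R i r
  | succ n ih =>
    rw [visitProb_harmonic hp, finVisitProb]
    have := E_le_one hp i
    exact add_le_add (mul_le_mul_of_nonneg_left (ih _ _) (E_pos hp i).le)
      (mul_le_mul_of_nonneg_left (ih _ _) (by linarith))

lemma tendsto_finVisitProb (hp : ∀ i, 1 ≤ i → 0 ≤ p i ∧ p i < 1 / 2) (htrans : Dinf p 0 < ⊤)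
    (R i r : ℕ) :
    Tendsto (fun n => finVisitProb p R {0} n i r) atTop (𝓝 (visitProb p R i r)) := by
  have hconv : ∀ i r, ∃ l, Tendsto (fun n => finVisitProb p R {0} n i r) atTop (𝓝 l) :=
    fun i r => ⟨_, tendsto_atTop_ciSup (finVisitProb_mono hp R i r)
      ⟨visitProb p R i r, by
        rintro _ ⟨n, rfl⟩
        exact finVisitProb_le_visitProb hp htrans R n i r⟩⟩
  choose G hG using hconv
  have hGrec : ∀ i r, G i r = E p i * G (i + 1) (remaining R i r) +
      (1 - E p i) * G (i - 1) (remaining R i r) := fun i r =>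
    tendsto_nhds_unique ((tendsto_add_atTop_iff_nat 1).2 (hG i r))
      (((hG _ _).const_mul _).add ((hG _ _).const_mul _))
  have hle : ∀ i r, G i r ≤ visitProb p R i r := fun i r =>
    le_of_tendsto' (hG i r) fun n => finVisitProb_le_visitProb hp htrans R n i r
  have hG0 : ∀ i r, 0 ≤ G i r := fun i r =>
    ge_of_tendsto' (hG i r) fun n => finVisitProb_nonneg hp R _ n i r
  have key : ∀ r i, visitProb p R i r - G i r = 0 := by
    intro r
    induction r with
    | zero =>
      intro i
      have := hG i 0
      simp only [finVisitProb_zero_right] at this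
      rw [tendsto_nhds_unique this tendsto_const_nhds, visitProb, sub_self]
    | succ r ih =>
      refine eq_zero_of_harmonic (R := R) hp htrans (fun i => sub_nonneg.2 (hle i _)) ?_
        (fun i => ?_) fun i hi => ?_
      · rw [hGrec, visitProb_harmonic hp]
        have e : remaining R R (r + 1) = r := by simp [remaining]
        rw [e]
        linear_combination E p R * ih (R + 1) + (1 - E p R) * ih (R - 1)
      · linarith [hG0 i (r + 1), visitProb_succ_le hp htrans R i r]
      · have e : remaining R i (r + 1) = r + 1 := by simp [remaining, hi]
        have h1 := hGrec i (r + 1)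
        have h2 := visitProb_harmonic hp R i (r + 1)
        rw [e] at h1 h2
        linear_combination h2 - h1
  rw [sub_eq_zero.1 (key r i)]
  exact hG i r

end Analysis

/-- The number of visits to `R` during the time interval `[m, m + n]`. -/
def visits {Ω : Type*} (X : ℕ → Ω → ℕ) (R m n : ℕ) (ω : Ω) : ℕ :=
  ∑ k ∈ Finset.range (n + 1), if X (m + k) ω = R then 1 else 0

lemma visits_succ {Ω : Type*} (X : ℕ → Ω → ℕ) (R m n : ℕ) (ω : Ω) :
    visits X R m (n + 1) ω = visits X R (m + 1) n ω + if X m ω = R then 1 else 0 := by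
  rw [visits, Finset.sum_range_succ']
  simp only [add_zero, visits, add_assoc, add_comm 1]

lemma sub_visits_succ {Ω : Type*} (X : ℕ → Ω → ℕ) (R m n r : ℕ) (ω : Ω) :
    r - visits X R m (n + 1) ω = remaining R (X m ω) r - visits X R (m + 1) n ω := by
  rw [visits_succ, remaining]
  split_ifs <;> omega

section Probability

variable {Ω : Type*} [MeasurableSpace Ω] {P : Measure Ω} {X : ℕ → Ω → ℕ} {p : ℕ → ℝ} {b : ℕ}

/-- One direction of the Markov property; it holds without any measurability of `X`. -/
lemma measure_cylinder_inter_le (hp : ∀ i, 1 ≤ i → 0 ≤ p i ∧ p i < 1 / 2)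
    (hX : IsNNWalk P X p b) (R : ℕ) (S : Set ℕ) (n m r : ℕ) (u : ℕ → ℕ) (hu : u 0 = b) :
    P ({ω | ∀ k ≤ m, X k ω = u k} ∩ {ω | r - visits X R m n ω ∈ S}) ≤
      ENNReal.ofReal ((∏ k ∈ Finset.range m, step p (u k) (u (k + 1))) *
        finVisitProb p R S n (u m) r) := by
  induction n generalizing m r u with
  | zero =>
    by_cases h : remaining R (u m) r ∈ S
    · rw [finVisitProb, if_pos h, mul_one, ← hX.2 m u hu]
      exact measure_mono Set.inter_subset_left
    · refine (measure_mono_null (t := ∅) ?_ measure_empty).trans_le zero_le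
      rintro ω ⟨h1, h2⟩
      refine h ?_
      have e : r - visits X R m 0 ω = remaining R (u m) r := by
        rw [← h1 m le_rfl]
        simp only [visits, remaining, zero_add, Finset.sum_range_one, add_zero]
        split_ifs <;> simp
      rw [← e]
      exact h2
  | succ n ih =>
    set W := ∏ k ∈ Finset.range m, step p (u k) (u (k + 1))
    have hW0 : 0 ≤ W := Finset.prod_nonneg fun k _ => step_nonneg hp _ _
    let v : ℕ → ℕ → ℕ := fun j => Function.update u (m + 1) j
    have hv : ∀ j, ∀ k ≤ m, v j k = u k := fun j k hk =>
      Function.update_of_ne (by omega) _ _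
    have hvm : ∀ j, v j (m + 1) = j := fun j => Function.update_self _ _ _
    have hsub : {ω | ∀ k ≤ m, X k ω = u k} ∩ {ω | r - visits X R m (n + 1) ω ∈ S} ⊆
        ⋃ j, {ω | ∀ k ≤ m + 1, X k ω = v j k} ∩
          {ω | remaining R (u m) r - visits X R (m + 1) n ω ∈ S} := by
      rintro ω ⟨h1, h2⟩
      refine Set.mem_iUnion.2 ⟨X (m + 1) ω, fun k hk => ?_, ?_⟩
      · rcases Nat.lt_or_ge m k with h | h
        · obtain rfl : k = m + 1 := by omega
          rw [hvm]
        · rw [hv _ k h, h1 k h]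
      · rw [Set.mem_ofPred_eq, sub_visits_succ, h1 m le_rfl] at h2
        exact h2
    let g : ℕ → ℝ := fun j => W * step p (u m) j *
      finVisitProb p R S n j (remaining R (u m) r)
    have hg0 : ∀ j, 0 ≤ g j := fun j =>
      mul_nonneg (mul_nonneg hW0 (step_nonneg hp _ _)) (finVisitProb_nonneg hp R S n _ _)
    have hbound : ∀ j, P ({ω | ∀ k ≤ m + 1, X k ω = v j k} ∩
          {ω | remaining R (u m) r - visits X R (m + 1) n ω ∈ S}) ≤ ENNReal.ofReal (g j) := by
      intro j
      refine (ih (m + 1) (remaining R (u m) r) (v j) ((hv j 0 (by omega)).trans hu)).trans_eq ?_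
      rw [Finset.prod_range_succ, hvm, hv j m le_rfl]
      congr 3
      refine Finset.prod_congr rfl fun k hk => ?_
      have := Finset.mem_range.1 hk
      rw [hv j k (by omega), hv j (k + 1) (by omega)]
    calc P ({ω | ∀ k ≤ m, X k ω = u k} ∩ {ω | r - visits X R m (n + 1) ω ∈ S})
        ≤ ∑' j, ENNReal.ofReal (g j) :=
          ((measure_mono hsub).trans (measure_iUnion_le _)).trans (ENNReal.tsum_le_tsum hbound)
      _ = ∑ j ∈ {u m + 1, u m - 1}, ENNReal.ofReal (g j) := by
          refine tsum_eq_sum fun j hj => ?_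
          simp only [Finset.mem_insert, Finset.mem_singleton, not_or] at hj
          simp [g, step_eq_zero p hj.1 hj.2]
      _ = ENNReal.ofReal (g (u m + 1) + g (u m - 1)) := by
          rw [Finset.sum_pair (by omega), ENNReal.ofReal_add (hg0 _) (hg0 _)]
      _ = _ := by
          simp only [g, step_succ, step_pred, finVisitProb]
          ring_nf

/-- A set whose outer measure and that of its complement add up correctly is null measurable. -/
lemma nullMeasurableSet_of_add_compl_le [IsFiniteMeasure P] {A : Set Ω}
    (h : P A + P Aᶜ ≤ P Set.univ) : NullMeasurableSet A P := by
  have hBm := measurableSet_toMeasurable P A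
  have hCm := measurableSet_toMeasurable P Aᶜ
  set B := toMeasurable P A
  set C := toMeasurable P Aᶜ
  have hAB : A ⊆ B := subset_toMeasurable P A
  have hAC : Aᶜ ⊆ C := subset_toMeasurable P Aᶜ
  have hU : B ∪ C = Set.univ :=
    Set.eq_univ_of_univ_subset ((Set.union_compl_self A).symm.subset.trans
      (Set.union_subset_union hAB hAC))
  have hnull : P (B ∩ C) = 0 := by
    have h1 := measure_union_add_inter B hCm (μ := P)
    rw [hU, measure_toMeasurable, measure_toMeasurable] at h1
    have h2 : P Set.univ + P (B ∩ C) ≤ P Set.univ + 0 := by rw [h1, add_zero]; exact h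
    exact nonpos_iff_eq_zero.1 ((ENNReal.add_le_add_iff_left (measure_ne_top P _)).1 h2)
  have hBA : B =ᵐ[P] A := by
    refine (ae_le_set.2 (measure_mono_null ?_ hnull)).antisymm hAB.eventuallyLE
    exact fun ω hω => ⟨hω.1, hAC hω.2⟩
  exact hBm.nullMeasurableSet.congr hBA

lemma measure_visits_le (hp : ∀ i, 1 ≤ i → 0 ≤ p i ∧ p i < 1 / 2)
    (hX : IsNNWalk P X p b) (R : ℕ) (S : Set ℕ) (n r : ℕ) :
    P {ω | r - visits X R 0 n ω ∈ S} ≤ ENNReal.ofReal (finVisitProb p R S n b r) := by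
  have h := measure_cylinder_inter_le hp hX R S n 0 r (fun _ => b) rfl
  simpa [hX.1] using h

lemma measure_visits_add_compl_le (hp : ∀ i, 1 ≤ i → 0 ≤ p i ∧ p i < 1 / 2)
    (hX : IsNNWalk P X p b) (R : ℕ) (S : Set ℕ) (n r : ℕ) :
    ENNReal.ofReal (finVisitProb p R S n b r) + P {ω | r - visits X R 0 n ω ∈ S}ᶜ ≤ 1 := by
  refine (add_le_add_right (measure_visits_le hp hX R Sᶜ n r) _).trans_eq ?_
  rw [← ENNReal.ofReal_add (finVisitProb_nonneg hp _ _ _ _ _) (finVisitProb_nonneg hp _ _ _ _ _),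
    finVisitProb_add_compl, ENNReal.ofReal_one]

lemma nullMeasurableSet_visits [IsProbabilityMeasure P] (hp : ∀ i, 1 ≤ i → 0 ≤ p i ∧ p i < 1 / 2)
    (hX : IsNNWalk P X p b) (R : ℕ) (S : Set ℕ) (n r : ℕ) :
    NullMeasurableSet {ω | r - visits X R 0 n ω ∈ S} P := by
  refine nullMeasurableSet_of_add_compl_le ?_
  rw [measure_univ]
  exact (add_le_add_left (measure_visits_le hp hX R S n r) _).trans
    (measure_visits_add_compl_le hp hX R S n r)

lemma measure_visits [IsProbabilityMeasure P] (hp : ∀ i, 1 ≤ i → 0 ≤ p i ∧ p i < 1 / 2)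
    (hX : IsNNWalk P X p b) (R : ℕ) (S : Set ℕ) (n r : ℕ) :
    P {ω | r - visits X R 0 n ω ∈ S} = ENNReal.ofReal (finVisitProb p R S n b r) := by
  refine le_antisymm (measure_visits_le hp hX R S n r) ?_
  refine (ENNReal.add_le_add_iff_right
    (measure_ne_top P {ω | r - visits X R 0 n ω ∈ S}ᶜ)).1 ?_
  refine (measure_visits_add_compl_le hp hX R S n r).trans ?_
  rw [← measure_univ (μ := P), ← Set.union_compl_self {ω | r - visits X R 0 n ω ∈ S}]
  exact measure_union_le _ _

end Probability

section LocalTime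

variable {Ω : Type*} (X : ℕ → Ω → ℕ) (R : ℕ)

lemma localTime_eq_iSup (ω : Ω) : localTime X R ω = ⨆ n, (visits X R 0 n ω : ℝ≥0∞) := by
  rw [localTime, ENNReal.tsum_eq_iSup_nat' (Filter.tendsto_add_atTop_nat 1)]
  simp [visits, Set.indicator_apply]

lemma lt_localTime_iff (l : ℕ) (ω : Ω) :
    (l : ℝ≥0∞) < localTime X R ω ↔ ∃ n, l + 1 - visits X R 0 n ω ∈ ({0} : Set ℕ) := by
  rw [localTime_eq_iSup, lt_iSup_iff]
  simp only [Nat.cast_lt, Set.mem_singleton_iff, Nat.sub_eq_zero_iff_le, Nat.succ_le_iff]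

lemma add_one_le_localTime {l : ℕ} {ω : Ω} (h : (l : ℝ≥0∞) < localTime X R ω) :
    (l : ℝ≥0∞) + 1 ≤ localTime X R ω := by
  rw [localTime_eq_iSup] at h ⊢
  obtain ⟨n, hn⟩ := lt_iSup_iff.1 h
  exact le_iSup_of_le n (by exact_mod_cast hn)

lemma setOf_lt_localTime (l : ℕ) :
    {ω | (l : ℝ≥0∞) < localTime X R ω} =
      ⋃ n, {ω | l + 1 - visits X R 0 n ω ∈ ({0} : Set ℕ)} := by
  ext ω
  simp only [Set.mem_ofPred_eq, Set.mem_iUnion, lt_localTime_iff]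

lemma setOf_localTime_eq (l : ℕ) :
    {ω | localTime X R ω = ((l + 1 : ℕ) : ℝ≥0∞)} =
      {ω | (l : ℝ≥0∞) < localTime X R ω} \ {ω | ((l + 1 : ℕ) : ℝ≥0∞) < localTime X R ω} := by
  ext ω
  simp only [Set.mem_ofPred_eq, Set.mem_sdiff, not_lt]
  constructor
  · intro h
    rw [h]
    exact ⟨by exact_mod_cast Nat.lt_succ_self l, le_rfl⟩
  · rintro ⟨h1, h2⟩
    refine le_antisymm h2 ?_
    push_cast
    exact add_one_le_localTime X R h1

lemma monotone_visits (m : ℕ) (ω : Ω) : Monotone fun n => visits X R m n ω := fun a b hab =>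
  Finset.sum_le_sum_of_subset (Finset.range_mono (by omega))

end LocalTime

lemma measure_lt_localTime {Ω : Type*} [MeasurableSpace Ω] {P : Measure Ω}
    [IsProbabilityMeasure P] {X : ℕ → Ω → ℕ} {p : ℕ → ℝ} {b : ℕ}
    (hp : ∀ i, 1 ≤ i → 0 ≤ p i ∧ p i < 1 / 2) (htrans : Dinf p 0 < ⊤)
    (hX : IsNNWalk P X p b) (R l : ℕ) :
    P {ω | (l : ℝ≥0∞) < localTime X R ω} = ENNReal.ofReal (visitProb p R b (l + 1)) := by
  rw [setOf_lt_localTime]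
  have hmono : Monotone fun n => {ω | l + 1 - visits X R 0 n ω ∈ ({0} : Set ℕ)} := by
    intro a c hac ω h
    have := monotone_visits X R 0 ω hac
    simp only [Set.mem_ofPred_eq, Set.mem_singleton_iff] at h this ⊢
    omega
  refine tendsto_nhds_unique (tendsto_measure_iUnion_atTop hmono) ?_
  simp only [Function.comp_def, measure_visits hp hX]
  exact ENNReal.tendsto_ofReal (tendsto_finVisitProb hp htrans R b (l + 1))

end NNRW

open NNRW
/-- for a transient chain, the total local time at `R` is geometric with
parameter `(1 + 2 p_R)/(2 D(R,∞))`. -/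
theorem stmt8 (p : ℕ → ℝ) (hp : ∀ i, 1 ≤ i → 0 ≤ p i ∧ p i < 1 / 2)
    (hp0 : p 0 = 1 / 2) (htrans : Dinf p 0 < ⊤)
    (Ω : Type) [MeasurableSpace Ω] (P : Measure Ω) [IsProbabilityMeasure P]
    (X : ℕ → Ω → ℕ) (hX : IsNNWalk P X p 0) :
    ∀ R L : ℕ, 1 ≤ L →
      P {ω | localTime X R ω = (L : ℝ≥0∞)} =
        ENNReal.ofReal ((1 + 2 * p R) / (2 * (Dinf p R).toReal) *
          (1 - (1 + 2 * p R) / (2 * (Dinf p R).toReal)) ^ (L - 1)) := by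
  intro R L hL
  obtain ⟨l, rfl⟩ : ∃ l, L = l + 1 := ⟨L - 1, by omega⟩
  have hq : (1 + 2 * p R) / (2 * (Dinf p R).toReal) = escProb p R := by
    have hE : E p R = 1 / 2 + p R := by
      rcases R with _ | R
      · rw [E_zero, hp0]
        norm_num
      · simp [E]
    have := one_le_Dinf hp htrans R
    rw [escProb, hE]
    field_simp
  have hsub : {ω | ((l + 1 : ℕ) : ℝ≥0∞) < localTime X R ω} ⊆
      {ω | (l : ℝ≥0∞) < localTime X R ω} := fun ω hω =>
    lt_trans (b := ((l + 1 : ℕ) : ℝ≥0∞)) (Nat.cast_lt.2 l.lt_succ_self) hω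
  have hnull : NullMeasurableSet {ω | ((l + 1 : ℕ) : ℝ≥0∞) < localTime X R ω} P := by
    rw [setOf_lt_localTime]
    exact .iUnion fun n => nullMeasurableSet_visits hp hX R {0} n _
  rw [hq, setOf_localTime_eq, measure_sdiff hsub hnull (measure_ne_top P _),
    measure_lt_localTime hp htrans hX, measure_lt_localTime hp htrans hX,
    ← ENNReal.ofReal_sub _ (visitProb_nonneg hp htrans R 0 _)]
  simp only [visitProb, hitProb_of_le p (Nat.zero_le R), Nat.add_sub_cancel]
  congr 1
  ring
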